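/- arXiv:1308.1423 — 2 statements merged into one kernel-verified Lean document; each statement's English description precedes it below -/
import Mathlib

section
/- Let d ≥ 1, let A be a real symmetric positive definite d × d matrix, let a > 0, set α = 1/4, and define γ : ℝ^d \ {0} → ℝ by γ(ξ) = a^{1/2} ⟨Aξ, ξ⟩^{α}. Then for every ξ ≠ 0, |det Hess γ(ξ)| = a^{d/2} (2α)^d |2α − 1| (det A) ⟨Aξ, ξ⟩^{(α−1)d}. -/
open Matrix

/-- The Hessian matrix of `f : ℝ^d → ℝ` at `x`, with entries
`(Hess f)(x)_{jk} = ∂²f/∂x_j∂x_k (x)`. -/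
noncomputable def hessianMatrixPi {d : ℕ} (f : (Fin d → ℝ) → ℝ) (x : Fin d → ℝ) :
    Matrix (Fin d) (Fin d) ℝ :=
  Matrix.of fun j k =>
    fderiv ℝ (fun z => fderiv ℝ f z (Pi.single k 1)) x (Pi.single j 1)

section HessianOfQuadraticPower

variable {d : ℕ}

theorem hasFDerivAt_mulVec_dotProduct {A : Matrix (Fin d) (Fin d) ℝ} (hA : A.IsSymm)
    (z : Fin d → ℝ) :
    HasFDerivAt (fun z => A *ᵥ z ⬝ᵥ z)
      (∑ i, (2 * (A *ᵥ z) i) • ContinuousLinearMap.proj (R := ℝ) (φ := fun _ : Fin d => ℝ) i)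
      z := by
  have hL (i : Fin d) := (LinearMap.toContinuousLinearMap
    ((LinearMap.proj i).comp A.mulVecLin)).hasFDerivAt (x := z)
  have hp (i : Fin d) := (ContinuousLinearMap.proj (R := ℝ)
    (φ := fun _ : Fin d => ℝ) i).hasFDerivAt (x := z)
  have h := HasFDerivAt.fun_sum (u := Finset.univ) fun i _ => (hL i).mul (hp i)
  refine h.congr_fderiv ?_
  ext v
  have hv : z ⬝ᵥ A *ᵥ v = A *ᵥ z ⬝ᵥ v := by
    rw [dotProduct_mulVec, ← mulVec_transpose, hA.eq]
  simp only [dotProduct] at hv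
  simp [Finset.sum_add_distrib, hv, two_mul, add_mul]

theorem fderiv_const_mul_quadratic_rpow {A : Matrix (Fin d) (Fin d) ℝ} (hA : A.IsSymm)
    (b α : ℝ) {z : Fin d → ℝ} (hz : A *ᵥ z ⬝ᵥ z ≠ 0) (k : Fin d) :
    fderiv ℝ (fun z => b * (A *ᵥ z ⬝ᵥ z) ^ α) z (Pi.single k 1)
      = 2 * b * α * (A *ᵥ z ⬝ᵥ z) ^ (α - 1) * (A *ᵥ z) k := by
  rw [(((hasFDerivAt_mulVec_dotProduct hA z).rpow_const (Or.inl hz)).const_mul b).fderiv]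
  simp [Pi.single_apply]
  ring

theorem hessianMatrixPi_const_mul_quadratic_rpow {A : Matrix (Fin d) (Fin d) ℝ}
    (hA : A.IsSymm) (b α : ℝ) {x : Fin d → ℝ} (hx : A *ᵥ x ⬝ᵥ x ≠ 0) :
    hessianMatrixPi (fun z => b * (A *ᵥ z ⬝ᵥ z) ^ α) x
      = (2 * b * α * (A *ᵥ x ⬝ᵥ x) ^ (α - 1)) •
          (A * (1 + vecMulVec x ((2 * (α - 1) / (A *ᵥ x ⬝ᵥ x)) • A *ᵥ x))) := by
  ext j k
  have hq := hasFDerivAt_mulVec_dotProduct hA x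
  have hL := (LinearMap.toContinuousLinearMap
    ((LinearMap.proj k).comp A.mulVecLin)).hasFDerivAt (x := x)
  have hgrad : (fun z => fderiv ℝ (fun z => b * (A *ᵥ z ⬝ᵥ z) ^ α) z (Pi.single k 1))
      =ᶠ[nhds x] fun z => 2 * b * α * (A *ᵥ z ⬝ᵥ z) ^ (α - 1) * (A *ᵥ z) k := by
    filter_upwards [hq.continuousAt.eventually_ne hx] with z hz
    exact fderiv_const_mul_quadratic_rpow hA b α hz k
  have hderiv := ((hq.rpow_const (p := α - 1) (Or.inl hx)).const_mul (2 * b * α)).mul hL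
  have hfd := (hderiv.congr_of_eventuallyEq hgrad).fderiv
  simp only [hessianMatrixPi, of_apply]
  rw [hfd, mul_add, mul_one, mul_vecMulVec]
  simp [Pi.single_apply, vecMulVec_apply, Real.rpow_sub_one hx, hA.apply j k]
  field_simp

theorem det_hessianMatrixPi_const_mul_quadratic_rpow {A : Matrix (Fin d) (Fin d) ℝ}
    (hA : A.IsSymm) (b α : ℝ) {x : Fin d → ℝ} (hx : A *ᵥ x ⬝ᵥ x ≠ 0) :
    (hessianMatrixPi (fun z => b * (A *ᵥ z ⬝ᵥ z) ^ α) x).det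
      = (2 * b * α * (A *ᵥ x ⬝ᵥ x) ^ (α - 1)) ^ d * (A.det * (2 * α - 1)) := by
  rw [hessianMatrixPi_const_mul_quadratic_rpow hA b α hx, det_smul, det_mul,
    vecMulVec_eq Unit, det_one_add_replicateCol_mul_replicateRow, smul_dotProduct, smul_eq_mul,
    div_mul_cancel₀ _ hx, Fintype.card_fin]
  ring

end HessianOfQuadraticPower

/-- For `A` symmetric positive definite, `a > 0`, `α = 1/4` and
`γ(ξ) = a^{1/2} ⟨Aξ, ξ⟩^α`, one has, for `ξ ≠ 0`,
`|det Hess γ(ξ)| = a^{d/2} (2α)^d |2α − 1| (det A) ⟨Aξ, ξ⟩^{(α−1)d}`. -/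
theorem stmt_8 (d : ℕ) (hd : 1 ≤ d) (A : Matrix (Fin d) (Fin d) ℝ) (hA : A.PosDef)
    (a : ℝ) (ha : 0 < a) (α : ℝ) (hα : α = 1 / 4) :
    ∀ ξ : Fin d → ℝ, ξ ≠ 0 →
      |(hessianMatrixPi (fun z => a ^ ((1 : ℝ) / 2) * (A.mulVec z ⬝ᵥ z) ^ α) ξ).det|
        = a ^ ((d : ℝ) / 2) * (2 * α) ^ d * |2 * α - 1| * A.det
            * (A.mulVec ξ ⬝ᵥ ξ) ^ ((α - 1) * d) := by
  intro ξ hξ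
  have hU : 0 < A *ᵥ ξ ⬝ᵥ ξ := by
    simpa [dotProduct_comm] using hA.dotProduct_mulVec_pos hξ
  have hsymm : A.IsSymm := by simpa [IsHermitian, IsSymm] using hA.isHermitian
  have hα₀ : 0 < α := by rw [hα]; norm_num
  rw [det_hessianMatrixPi_const_mul_quadratic_rpow hsymm _ _ hU.ne', abs_mul, abs_mul,
    abs_of_pos hA.det_pos, abs_of_pos (by positivity), Real.rpow_mul hU.le, Real.rpow_natCast,
    show (d : ℝ) / 2 = 1 / 2 * d by ring, Real.rpow_mul ha.le, Real.rpow_natCast]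
  ring
end

section
/- Let d ≥ 1, c > 0 and K ≥ 0. There exists c₀ > 0, depending only on d, c and K, with the following property: for every a ∈ ℝ with a ≥ c and every v ∈ ℝ^d with ‖v‖ ≤ K, the function γ(ξ) = (a² ((1 + ‖v‖²)‖ξ‖² − ⟨ξ, v⟩²))^{1/4} satisfies |det Hess γ(ξ)| ≥ c₀ for all ξ ∈ ℝ^d with 1/2 ≤ ‖ξ‖ ≤ 2. -/
open scoped RealInnerProductSpace

/-- The Hessian matrix of `f : ℝ^d → ℝ` at `x`, with entries
`(Hess f)(x)_{jk} = ∂²f/∂x_j∂x_k (x)`. -/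
noncomputable def hessianMatrix {d : ℕ} (f : EuclideanSpace ℝ (Fin d) → ℝ)
    (x : EuclideanSpace ℝ (Fin d)) : Matrix (Fin d) (Fin d) ℝ :=
  Matrix.of fun j k =>
    fderiv ℝ (fun z => fderiv ℝ f z (EuclideanSpace.single k 1)) x (EuclideanSpace.single j 1)

theorem hasFDerivAt_inner_clm_self {E : Type*} [NormedAddCommGroup E] [InnerProductSpace ℝ E]
    (T : E →L[ℝ] E) (hT : ∀ x y, ⟪T x, y⟫ = ⟪x, T y⟫) (x : E) :
    HasFDerivAt (fun z => ⟪T z, z⟫) ((2 : ℝ) • innerSL ℝ (T x)) x := by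
  refine (T.hasFDerivAt.inner ℝ (hasFDerivAt_id x)).congr_fderiv ?_
  ext y
  simp only [ContinuousLinearMap.comp_apply, ContinuousLinearMap.prod_apply, fderivInnerCLM_apply,
    smul_apply, innerSL_apply_apply, smul_eq_mul, ContinuousLinearMap.id_apply,
    id_eq]
  rw [hT y x, real_inner_comm]
  ring

theorem fderiv_inner_clm_self_rpow {E : Type*} [NormedAddCommGroup E] [InnerProductSpace ℝ E]
    (T : E →L[ℝ] E) (hT : ∀ x y, ⟪T x, y⟫ = ⟪x, T y⟫) (p : ℝ) {x : E} (hx : 0 < ⟪T x, x⟫) (y : E) :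
    fderiv ℝ (fun z => ⟪T z, z⟫ ^ p) x y = 2 * p * ⟪T x, x⟫ ^ (p - 1) * ⟪T x, y⟫ := by
  rw [((hasFDerivAt_inner_clm_self T hT x).rpow_const (p := p) (Or.inl hx.ne')).fderiv]
  simp only [smul_apply, innerSL_apply_apply, smul_eq_mul]
  ring

theorem fderiv_fderiv_inner_clm_self_rpow {E : Type*} [NormedAddCommGroup E]
    [InnerProductSpace ℝ E] (T : E →L[ℝ] E) (hT : ∀ x y, ⟪T x, y⟫ = ⟪x, T y⟫) (p : ℝ) {x : E}
    (hx : 0 < ⟪T x, x⟫) (y w : E) :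
    fderiv ℝ (fun z => fderiv ℝ (fun z => ⟪T z, z⟫ ^ p) z y) x w =
      2 * p * ⟪T x, x⟫ ^ (p - 1) *
        (⟪T w, y⟫ + 2 * (p - 1) * ⟪T x, x⟫⁻¹ * ⟪T x, w⟫ * ⟪T x, y⟫) := by
  have hcont : Continuous fun z => ⟪T z, z⟫ := by fun_prop
  have hev : (fun z => fderiv ℝ (fun z => ⟪T z, z⟫ ^ p) z y) =ᶠ[nhds x]
      fun z => 2 * p * ⟪T z, z⟫ ^ (p - 1) * ⟪T z, y⟫ := by
    filter_upwards [hcont.continuousAt.eventually_const_lt hx] with z hz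
    exact fderiv_inner_clm_self_rpow T hT p hz y
  have h1 := ((hasFDerivAt_inner_clm_self T hT x).rpow_const (p := p - 1)
    (Or.inl hx.ne')).const_mul (2 * p)
  have h2 := (T.hasFDerivAt (x := x)).inner ℝ (hasFDerivAt_const y x)
  rw [hev.fderiv_eq, (h1.fun_mul h2).fderiv]
  simp only [ContinuousLinearMap.comp_apply, ContinuousLinearMap.prod_apply, fderivInnerCLM_apply,
    smul_apply, add_apply, innerSL_apply_apply,
    smul_eq_mul, zero_apply, inner_zero_right]
  rw [Real.rpow_sub_one hx.ne' (p - 1)]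
  ring

theorem hessianMatrix_inner_toEuclideanCLM_rpow {d : ℕ} {B : Matrix (Fin d) (Fin d) ℝ}
    (hB : B.IsSymm) (p : ℝ) {x : EuclideanSpace ℝ (Fin d)}
    (hx : 0 < ⟪Matrix.toEuclideanCLM (𝕜 := ℝ) B x, x⟫) :
    hessianMatrix (fun z => ⟪Matrix.toEuclideanCLM (𝕜 := ℝ) B z, z⟫ ^ p) x =
      (2 * p * ⟪Matrix.toEuclideanCLM (𝕜 := ℝ) B x, x⟫ ^ (p - 1)) •
        (B * (1 + Matrix.vecMulVec
          ((2 * (p - 1) * ⟪Matrix.toEuclideanCLM (𝕜 := ℝ) B x, x⟫⁻¹) • x.ofLp)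
          (B.mulVec x.ofLp))) := by
  have hT : ∀ x y, ⟪Matrix.toEuclideanCLM (𝕜 := ℝ) B x, y⟫ =
      ⟪x, Matrix.toEuclideanCLM (𝕜 := ℝ) B y⟫ := by
    intro x y
    simp only [EuclideanSpace.inner_eq_star_dotProduct, Matrix.ofLp_toEuclideanCLM, star_trivial]
    rw [Matrix.dotProduct_mulVec, ← Matrix.mulVec_transpose, hB.eq, dotProduct_comm]
  ext j k
  rw [hessianMatrix, Matrix.of_apply, fderiv_fderiv_inner_clm_self_rpow _ hT p hx]
  simp only [EuclideanSpace.inner_single_right, Matrix.ofLp_toEuclideanCLM, Matrix.mul_add,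
    Matrix.mul_one, Matrix.mul_vecMulVec, Matrix.smul_apply, Matrix.add_apply,
    Matrix.vecMulVec_apply, Matrix.mulVec_smul, Pi.smul_apply, smul_eq_mul,
    PiLp.ofLp_single, Matrix.mulVec_single_one, Matrix.col_apply, hB.apply]
  simp

theorem det_hessianMatrix_inner_toEuclideanCLM_rpow {d : ℕ} {B : Matrix (Fin d) (Fin d) ℝ}
    (hB : B.IsSymm) (p : ℝ) {x : EuclideanSpace ℝ (Fin d)}
    (hx : 0 < ⟪Matrix.toEuclideanCLM (𝕜 := ℝ) B x, x⟫) :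
    (hessianMatrix (fun z => ⟪Matrix.toEuclideanCLM (𝕜 := ℝ) B z, z⟫ ^ p) x).det =
      (2 * p * ⟪Matrix.toEuclideanCLM (𝕜 := ℝ) B x, x⟫ ^ (p - 1)) ^ d * B.det * (2 * p - 1) := by
  have hq : B.mulVec x.ofLp ⬝ᵥ x.ofLp = ⟪Matrix.toEuclideanCLM (𝕜 := ℝ) B x, x⟫ := by
    rw [EuclideanSpace.inner_eq_star_dotProduct, Matrix.ofLp_toEuclideanCLM, star_trivial,
      dotProduct_comm]
  rw [hessianMatrix_inner_toEuclideanCLM_rpow hB p hx, Matrix.det_smul, Matrix.det_mul,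
    Matrix.vecMulVec_eq Unit, Matrix.det_one_add_replicateCol_mul_replicateRow, dotProduct_smul,
    hq, smul_eq_mul, Fintype.card_fin, mul_assoc (2 * (p - 1)), inv_mul_cancel₀ hx.ne']
  ring

theorem det_smul_one_sub_vecMulVec_self {d : ℕ} {s : ℝ} (hs : s ≠ 0) (v : Fin d → ℝ) :
    (s • (1 : Matrix (Fin d) (Fin d) ℝ) - Matrix.vecMulVec v v).det =
      s ^ d * (1 - s⁻¹ * (v ⬝ᵥ v)) := by
  have h : s • (1 : Matrix (Fin d) (Fin d) ℝ) - Matrix.vecMulVec v v =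
      s • (1 + Matrix.vecMulVec ((-s⁻¹) • v) v) := by
    rw [Matrix.smul_vecMulVec, smul_add, smul_smul, mul_neg, mul_inv_cancel₀ hs, neg_one_smul,
      sub_eq_add_neg]
  rw [h, Matrix.det_smul, Matrix.vecMulVec_eq Unit,
    Matrix.det_one_add_replicateCol_mul_replicateRow, dotProduct_smul, Fintype.card_fin,
    smul_eq_mul]
  ring

/-- There is `c₀ > 0` depending only on `d, c, K` such that for every
`a ≥ c` and `‖v‖ ≤ K`, the symbol `γ(ξ) = (a²((1+‖v‖²)‖ξ‖² − ⟨ξ,v⟩²))^{1/4}` satisfies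
`|det Hess γ(ξ)| ≥ c₀` on the annulus `1/2 ≤ ‖ξ‖ ≤ 2`. -/
theorem stmt_9 (d : ℕ) (hd : 1 ≤ d) (c K : ℝ) (hc : 0 < c) (hK : 0 ≤ K) :
    ∃ c₀ > 0, ∀ a : ℝ, c ≤ a → ∀ v : EuclideanSpace ℝ (Fin d), ‖v‖ ≤ K →
      ∀ ξ : EuclideanSpace ℝ (Fin d), 1 / 2 ≤ ‖ξ‖ → ‖ξ‖ ≤ 2 →
        c₀ ≤ |(hessianMatrix
            (fun x => (a ^ 2 * ((1 + ‖v‖ ^ 2) * ‖x‖ ^ 2 - ⟪x, v⟫ ^ 2)) ^ ((1 : ℝ) / 4))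
            ξ).det| := by
  refine ⟨1 / 2 * (1 / 2 * ((c ^ 2) ^ ((1 : ℝ) / 4) * (4 * (1 + K ^ 2)) ^ (-(3 : ℝ) / 4))) ^ d,
    by positivity, ?_⟩
  intro a ha v hv ξ hξ hξ'
  have ha0 : 0 < a := hc.trans_le ha
  have hs : 0 < 1 + ‖v‖ ^ 2 := by positivity
  set B : Matrix (Fin d) (Fin d) ℝ :=
    a ^ 2 • ((1 + ‖v‖ ^ 2) • 1 - Matrix.vecMulVec v.ofLp v.ofLp) with hB
  have hsymm : B.IsSymm := by
    simp [hB, Matrix.IsSymm, Matrix.transpose_vecMulVec]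
  have hq : ∀ x : EuclideanSpace ℝ (Fin d), ⟪Matrix.toEuclideanCLM (𝕜 := ℝ) B x, x⟫ =
      a ^ 2 * ((1 + ‖v‖ ^ 2) * ‖x‖ ^ 2 - ⟪x, v⟫ ^ 2) := by
    intro x
    rw [← real_inner_self_eq_norm_sq x]
    simp only [EuclideanSpace.inner_eq_star_dotProduct, Matrix.ofLp_toEuclideanCLM, star_trivial,
      hB, Matrix.smul_mulVec, Matrix.sub_mulVec, Matrix.one_mulVec, Matrix.vecMulVec_mulVec,
      dotProduct_smul, dotProduct_sub, smul_eq_mul, op_smul_eq_smul]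
    rw [dotProduct_comm x.ofLp v.ofLp]
    ring
  have hξ0 : 0 < ‖ξ‖ := by linarith
  have hcs : ⟪ξ, v⟫ ^ 2 ≤ ‖ξ‖ ^ 2 * ‖v‖ ^ 2 := by
    rw [← mul_pow]
    exact sq_le_sq' (neg_le_of_abs_le (abs_real_inner_le_norm ξ v)) (real_inner_le_norm ξ v)
  have hpos : 0 < ⟪Matrix.toEuclideanCLM (𝕜 := ℝ) B ξ, ξ⟫ := by
    rw [hq]
    refine mul_pos (by positivity) ?_
    nlinarith [pow_pos hξ0 2]
  have hle : ⟪Matrix.toEuclideanCLM (𝕜 := ℝ) B ξ, ξ⟫ ≤ a ^ 2 * (4 * (1 + K ^ 2)) := by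
    rw [hq]
    have h1 : (1 + ‖v‖ ^ 2) * ‖ξ‖ ^ 2 ≤ (1 + K ^ 2) * 2 ^ 2 := by gcongr
    gcongr
    nlinarith [sq_nonneg ⟪ξ, v⟫]
  have hdet : (a ^ 2) ^ d ≤ B.det := by
    have hd' : (1 + ‖v‖ ^ 2) ^ d * (1 - (1 + ‖v‖ ^ 2)⁻¹ * ‖v‖ ^ 2) = (1 + ‖v‖ ^ 2) ^ (d - 1) := by
      obtain ⟨n, rfl⟩ := Nat.exists_eq_add_of_le' hd
      rw [Nat.add_sub_cancel, pow_succ]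
      field_simp
      ring
    have hvv : v.ofLp ⬝ᵥ v.ofLp = ‖v‖ ^ 2 := by
      rw [← real_inner_self_eq_norm_sq, EuclideanSpace.inner_eq_star_dotProduct, star_trivial]
    rw [hB, Matrix.det_smul, Fintype.card_fin, det_smul_one_sub_vecMulVec_self hs.ne', hvv, hd']
    exact le_mul_of_one_le_right (by positivity)
      (one_le_pow₀ (le_add_of_nonneg_right (sq_nonneg _)))
  simp only [← hq]
  rw [det_hessianMatrix_inner_toEuclideanCLM_rpow hsymm _ hpos]
  set q := ⟪Matrix.toEuclideanCLM (𝕜 := ℝ) B ξ, ξ⟫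
  have hbase : (c ^ 2) ^ ((1 : ℝ) / 4) * (4 * (1 + K ^ 2)) ^ (-(3 : ℝ) / 4) ≤
      q ^ (-(3 : ℝ) / 4) * a ^ 2 := by
    calc (c ^ 2) ^ ((1 : ℝ) / 4) * (4 * (1 + K ^ 2)) ^ (-(3 : ℝ) / 4)
        ≤ (a ^ 2) ^ ((1 : ℝ) / 4) * (4 * (1 + K ^ 2)) ^ (-(3 : ℝ) / 4) := by gcongr
      _ = (a ^ 2 * (4 * (1 + K ^ 2))) ^ (-(3 : ℝ) / 4) * a ^ 2 := by
        rw [Real.mul_rpow (x := a ^ 2) (by positivity) (by positivity), mul_right_comm,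
          ← Real.rpow_add_one (by positivity)]
        norm_num
      _ ≤ q ^ (-(3 : ℝ) / 4) * a ^ 2 := by
        gcongr ?_ * _
        exact Real.rpow_le_rpow_of_nonpos hpos hle (by norm_num)
  have hexp : (1 : ℝ) / 4 - 1 = -(3 : ℝ) / 4 := by norm_num
  have hB0 : 0 < B.det := lt_of_lt_of_le (by positivity) hdet
  rw [hexp, abs_mul, abs_of_pos (by positivity),
    show |2 * ((1 : ℝ) / 4) - 1| = 1 / 2 by norm_num [abs_of_neg], mul_comm _ ((1 : ℝ) / 2)]
  gcongr ?_ * ?_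
  calc (1 / 2 * ((c ^ 2) ^ ((1 : ℝ) / 4) * (4 * (1 + K ^ 2)) ^ (-(3 : ℝ) / 4))) ^ d
      ≤ (1 / 2 * (q ^ (-(3 : ℝ) / 4) * a ^ 2)) ^ d := by gcongr
    _ = (2 * (1 / 4) * q ^ (-(3 : ℝ) / 4)) ^ d * (a ^ 2) ^ d := by
      rw [← mul_pow]
      ring
    _ ≤ (2 * (1 / 4) * q ^ (-(3 : ℝ) / 4)) ^ d * B.det := by gcongr
end
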